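/- The tensor algebra A_n on planar rooted trees with n-coloured edges has a natural family of graded connected Hopf algebra structures indexed by sequences (q_{11},…,q_{1n},q_{21},…,q_{2n}) ∈ k^{2n}, graded by the number of vertices, with coproduct described inductively by Δ(λ(f_1,…,f_n)) = Σ q_{11}^{|f'_1|}⋯q_{1n}^{|f'_n|} f'_1⋯f'_n ⊗ λ(f''_1,…,f''_n) + Σ λ(f'_1,…,f'_n) ⊗ q_{21}^{|f''_1|}⋯q_{2n}^{|f''_n|} f''_1⋯f''_n, where Δ(f_i) = Σ f'_i ⊗ f''_i. -/

import Mathlib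

namespace CTrees

inductive PTree (n : ℕ) : Type where
  | node : List (Fin n × PTree n) → PTree n

/-- Two representatives define the same planar `n`-tree: at each vertex, the
incoming edges of each colour are linearly ordered, but the interleaving of
the different colours is immaterial. -/
inductive PlEquiv {n : ℕ} : PTree n → PTree n → Prop where
  | node {l₁ l₂ : List (Fin n × PTree n)}
      (h : ∀ i : Fin n, List.Forall₂ PlEquiv
        ((l₁.filter fun p => p.1 = i).map Prod.snd)
        ((l₂.filter fun p => p.1 = i).map Prod.snd)) :
      PlEquiv (.node l₁) (.node l₂)

/-- Planar `n`-trees: rooted trees with edges coloured by `{1,…,n}` and, at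
each vertex, a linear ordering of the incoming edges of each colour. -/
def PlTree (n : ℕ) : Type := Quot (@PlEquiv n)

variable {n : ℕ} (k : Type) [CommRing k]

/-- The element of the free associative algebra `A_n` given by a word of
planar `n`-trees. -/
noncomputable def wmon (w : List (PlTree n)) : FreeAlgebra k (PlTree n) :=
  (w.map (FreeAlgebra.ι k)).prod

/-- Grafting of an `n`-tuple of ordered forests (words of planar trees). -/
noncomputable def pgraftW (g : Fin n → List (PlTree n)) : PlTree n :=
  Quot.mk _ (PTree.node
    ((List.finRange n).flatMap fun i => (g i).map fun t => (i, Quot.out t)))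

mutual
/-- Number of vertices of a planar representative. -/
def psize : PTree n → ℕ
  | .node l => 1 + psizeL l
def psizeL : List (Fin n × PTree n) → ℕ
  | [] => 0
  | a :: l => psize a.2 + psizeL l
end

noncomputable def wsize (w : List (PlTree n)) : ℕ :=
  (w.map fun t => psize (Quot.out t)).sum

open scoped TensorProduct
open PiTensorProduct

/-- The augmentation of `A_n`. -/
noncomputable def augA (k : Type) [CommRing k] (n : ℕ) :
    FreeAlgebra k (PlTree n) →ₐ[k] k :=
  FreeAlgebra.lift k (fun _ : PlTree n => (0 : k))

section Combinatorics

theorem PlEquiv.refl {n : ℕ} : ∀ t : PTree n, PlEquiv t t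
  | .node l => .node fun i => List.forall₂_same.2 fun x hx => by
      obtain ⟨p, hp, rfl⟩ := List.mem_map.1 hx
      have := List.sizeOf_lt_of_mem (List.mem_of_mem_filter hp)
      exact PlEquiv.refl p.2
  decreasing_by
    obtain ⟨c, s⟩ := p
    simp only [Prod.mk.sizeOf_spec, PTree.node.sizeOf_spec] at *
    omega

theorem psizeL_eq_sum_colours {n : ℕ} (l : List (Fin n × PTree n)) :
    psizeL l = ∑ i : Fin n, (((l.filter fun p => p.1 = i).map Prod.snd).map psize).sum := by
  induction l with
  | nil => simp [psizeL]
  | cons a l ih =>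
    have h : ∀ i : Fin n, ((((a :: l).filter fun p => p.1 = i).map Prod.snd).map psize).sum
        = (if a.1 = i then psize a.2 else 0)
          + (((l.filter fun p => p.1 = i).map Prod.snd).map psize).sum := by
      intro i
      by_cases hi : a.1 = i <;> simp [hi]
    simp only [h, Finset.sum_add_distrib, ← ih, psizeL]
    simp

theorem forall₂_map_sum_eq {α : Type*} {R : α → α → Prop} {f : α → ℕ} {l₁ l₂ : List α}
    (h : List.Forall₂ R l₁ l₂) (hf : ∀ x ∈ l₁, ∀ y, R x y → f x = f y) :
    (l₁.map f).sum = (l₂.map f).sum := by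
  induction h with
  | nil => rfl
  | cons hxy _ ih =>
    simp only [List.mem_cons, forall_eq_or_imp] at hf
    simp [hf.1 _ hxy, ih hf.2]

theorem PlEquiv.psize_eq {n : ℕ} : ∀ {s t : PTree n}, PlEquiv s t → psize s = psize t
  | .node l₁, .node l₂, .node h => by
      simp only [psize, psizeL_eq_sum_colours]
      congr 1
      refine Finset.sum_congr rfl fun i _ => forall₂_map_sum_eq (h i) fun x hx y hxy => ?_
      obtain ⟨p, hp, rfl⟩ := List.mem_map.1 hx
      have := List.sizeOf_lt_of_mem (List.mem_of_mem_filter hp)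
      exact PlEquiv.psize_eq hxy
  termination_by s => sizeOf s
  decreasing_by
    obtain ⟨c, s⟩ := p
    simp only [Prod.mk.sizeOf_spec, PTree.node.sizeOf_spec] at *
    omega

theorem PlEquiv.symm {n : ℕ} : ∀ {s t : PTree n}, PlEquiv s t → PlEquiv t s
  | .node l₁, .node l₂, .node h => .node fun i => by
      refine List.Forall₂.flip ?_
      have key : ∀ x ∈ (l₁.filter fun p => p.1 = i).map Prod.snd, ∀ y, PlEquiv x y →
          PlEquiv y x := by
        intro x hx y hxy
        obtain ⟨p, hp, rfl⟩ := List.mem_map.1 hx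
        have := List.sizeOf_lt_of_mem (List.mem_of_mem_filter hp)
        exact PlEquiv.symm hxy
      have := h i
      generalize (l₁.filter fun p => p.1 = i).map Prod.snd = a at this key
      generalize (l₂.filter fun p => p.1 = i).map Prod.snd = b at this
      induction this with
      | nil => exact .nil
      | cons hxy _ ih =>
        simp only [List.mem_cons, forall_eq_or_imp] at key
        exact .cons (key.1 _ hxy) (ih key.2)
  termination_by s => sizeOf s
  decreasing_by
    obtain ⟨c, s⟩ := p
    simp only [Prod.mk.sizeOf_spec, PTree.node.sizeOf_spec] at *
    omega

theorem PlEquiv.trans {n : ℕ} : ∀ {s t u : PTree n}, PlEquiv s t → PlEquiv t u → PlEquiv s u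
  | .node l₁, .node l₂, .node l₃, .node h, .node h' => .node fun i => by
      have key : ∀ x ∈ (l₁.filter fun p => p.1 = i).map Prod.snd, ∀ y z, PlEquiv x y →
          PlEquiv y z → PlEquiv x z := by
        intro x hx y z hxy hyz
        obtain ⟨p, hp, rfl⟩ := List.mem_map.1 hx
        have := List.sizeOf_lt_of_mem (List.mem_of_mem_filter hp)
        exact PlEquiv.trans hxy hyz
      have h₁ := h i
      have h₂ := h' i
      generalize (l₁.filter fun p => p.1 = i).map Prod.snd = a at h₁ key
      generalize (l₂.filter fun p => p.1 = i).map Prod.snd = b at h₁ h₂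
      generalize (l₃.filter fun p => p.1 = i).map Prod.snd = c at h₂
      induction h₁ generalizing c with
      | nil => cases h₂; exact .nil
      | cons hxy _ ih =>
        simp only [List.mem_cons, forall_eq_or_imp] at key
        cases h₂ with
        | cons hyz hr => exact .cons (key.1 _ _ hxy hyz) (ih key.2 _ hr)
  termination_by s => sizeOf s
  decreasing_by
    obtain ⟨c, s⟩ := p
    simp only [Prod.mk.sizeOf_spec, PTree.node.sizeOf_spec] at *
    omega

theorem plEquiv_equivalence (n : ℕ) : Equivalence (@PlEquiv n) :=
  ⟨PlEquiv.refl, PlEquiv.symm, PlEquiv.trans⟩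

/-- The planar tree defined by a representative. -/
def PlTree.mk {n : ℕ} (s : PTree n) : PlTree n := Quot.mk _ s

/-- A representative of a planar tree. -/
noncomputable def PlTree.out {n : ℕ} (t : PlTree n) : PTree n := Quot.out t

theorem PlTree.mk_out {n : ℕ} (t : PlTree n) : PlTree.mk t.out = t := Quot.out_eq t

theorem PlTree.out_mk {n : ℕ} (s : PTree n) : PlEquiv (PlTree.mk s).out s :=
  (plEquiv_equivalence n).quot_mk_eq_iff _ _ |>.1 (Quot.out_eq _)

theorem PlTree.ind {n : ℕ} {P : PlTree n → Prop} (h : ∀ s, P (PlTree.mk s)) (t : PlTree n) : P t :=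
  Quot.ind h t

theorem pgraftW_eq {n : ℕ} (g : Fin n → List (PlTree n)) :
    pgraftW g = PlTree.mk (PTree.node
      ((List.finRange n).flatMap fun i => (g i).map fun t => (i, t.out))) := rfl

/-- The number of vertices of a planar tree. -/
noncomputable def tsize {n : ℕ} (t : PlTree n) : ℕ := psize t.out

theorem tsize_mk {n : ℕ} (s : PTree n) : tsize (PlTree.mk s) = psize s :=
  PlEquiv.psize_eq (PlTree.out_mk s)

theorem wsize_eq {n : ℕ} (w : List (PlTree n)) : wsize w = (w.map tsize).sum := rfl

theorem tsize_pos {n : ℕ} (t : PlTree n) : 0 < tsize t := by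
  unfold tsize
  cases t.out
  simp [psize]

theorem wsize_nil {n : ℕ} : wsize ([] : List (PlTree n)) = 0 := rfl

theorem wsize_cons {n : ℕ} (t : PlTree n) (w : List (PlTree n)) :
    wsize (t :: w) = tsize t + wsize w := by
  simp [wsize_eq]

theorem wsize_append {n : ℕ} (v w : List (PlTree n)) : wsize (v ++ w) = wsize v + wsize w := by
  simp [wsize_eq]

theorem wsize_singleton {n : ℕ} (t : PlTree n) : wsize [t] = tsize t := by
  simp [wsize_eq]

theorem wsize_eq_zero_iff {n : ℕ} {w : List (PlTree n)} : wsize w = 0 ↔ w = [] := by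
  cases w with
  | nil => simp [wsize_nil]
  | cons t w =>
    have := tsize_pos t
    simp [wsize_cons]
    omega

theorem tsize_le_wsize {n : ℕ} {t : PlTree n} {w : List (PlTree n)} (ht : t ∈ w) :
    tsize t ≤ wsize w :=
  List.le_sum_of_mem (List.mem_map_of_mem (f := tsize) ht)

theorem wsize_flatten {n : ℕ} (g : Fin n → List (PlTree n)) :
    wsize (List.ofFn g).flatten = ∑ i, wsize (g i) := by
  have : ∀ L : List (List (PlTree n)), wsize L.flatten = (L.map wsize).sum := by
    intro L
    induction L with
    | nil => simp [wsize_nil]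
    | cons a L ih => simp [wsize_append, ih]
  rw [this, List.map_ofFn, List.sum_ofFn]
  rfl

/-- The forest of subtrees hanging from the root of a representative by edges of a given
colour. -/
def PTree.children {n : ℕ} (i : Fin n) : PTree n → List (PlTree n)
  | .node l => ((l.filter fun p => p.1 = i).map Prod.snd).map PlTree.mk

theorem PlEquiv.children_eq {n : ℕ} {s t : PTree n} (h : PlEquiv s t) (i : Fin n) :
    s.children i = t.children i := by
  obtain @⟨l₁, l₂, h⟩ := h
  have := h i
  simp only [PTree.children]
  generalize List.map Prod.snd _ = a at this
  generalize List.map Prod.snd _ = b at this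
  induction this with
  | nil => rfl
  | cons hxy _ ih =>
    simp only [List.map_cons, ih, List.cons.injEq, and_true]
    exact Quot.sound hxy

/-- The forest of subtrees hanging from the root by edges of a given colour. -/
def children {n : ℕ} (t : PlTree n) (i : Fin n) : List (PlTree n) :=
  Quot.lift (PTree.children i) (fun _ _ h => h.children_eq i) t

theorem children_mk {n : ℕ} (l : List (Fin n × PTree n)) (i : Fin n) :
    children (PlTree.mk (.node l)) i
      = ((l.filter fun p => p.1 = i).map Prod.snd).map PlTree.mk := rfl

theorem filter_colour {n : ℕ} {α β : Type*} (g : Fin n → List α) (f : α → β) (c : Fin n) :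
    ((((List.finRange n).flatMap fun i => (g i).map fun t => (i, f t)).filter
      fun p => p.1 = c).map Prod.snd) = (g c).map f := by
  have : ∀ L : List (Fin n), L.Nodup → (((L.flatMap fun i => (g i).map fun t => (i, f t)).filter
      fun p => p.1 = c).map Prod.snd) = if c ∈ L then (g c).map f else [] := by
    intro L hL
    induction L with
    | nil => simp
    | cons a L ih =>
      rw [List.nodup_cons] at hL
      rw [List.flatMap_cons, List.filter_append, List.map_append, ih hL.2, List.filter_map]
      by_cases h : a = c
      · subst h
        simp [hL.1, Function.comp_def]
      · simp [h, Function.comp_def, Ne.symm h]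
  rw [this _ (List.nodup_finRange n), if_pos (List.mem_finRange c)]

theorem children_pgraftW {n : ℕ} (g : Fin n → List (PlTree n)) : children (pgraftW g) = g := by
  funext i
  rw [pgraftW_eq, children_mk, filter_colour]
  simp [Function.comp_def, PlTree.mk_out]

theorem pgraftW_children {n : ℕ} (t : PlTree n) : pgraftW (children t) = t := by
  induction t using PlTree.ind with
  | h s =>
    obtain ⟨l⟩ := s
    rw [pgraftW_eq]
    refine Quot.sound (.node fun i => ?_)
    rw [filter_colour, children_mk, List.map_map, List.forall₂_map_left_iff]
    exact List.forall₂_same.2 fun s _ => PlTree.out_mk s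

theorem tsize_pgraftW {n : ℕ} (g : Fin n → List (PlTree n)) :
    tsize (pgraftW g) = 1 + ∑ i, wsize (g i) := by
  rw [pgraftW_eq, tsize_mk, psize, psizeL_eq_sum_colours]
  congr 1
  refine Finset.sum_congr rfl fun i _ => ?_
  rw [filter_colour, List.map_map]
  rfl

theorem tsize_lt_of_mem_children {n : ℕ} {t s : PlTree n} {i : Fin n} (h : s ∈ children t i) :
    tsize s < tsize t := by
  rw [← pgraftW_children t, tsize_pgraftW]
  have h₁ := tsize_le_wsize h
  have h₂ := Finset.single_le_sum (f := fun i => wsize (children t i)) (fun _ _ => Nat.zero_le _)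
    (Finset.mem_univ i)
  omega

/-- Induction on planar trees, through the words grafted to the root. -/
theorem PlTree.graft_induction {n : ℕ} {P : PlTree n → Prop}
    (h : ∀ g : Fin n → List (PlTree n), (∀ i, ∀ s ∈ g i, P s) → P (pgraftW g)) (t : PlTree n) :
    P t := by
  induction ht : tsize t using Nat.strong_induction_on generalizing t with
  | _ m ih =>
    rw [← pgraftW_children t]
    exact h _ fun i s hs => ih _ (ht ▸ tsize_lt_of_mem_children hs) s rfl

end Combinatorics

section Antipode

open Coalgebra WithConv

variable {k A κ : Type*} [CommRing k] [Ring A] [Algebra k A] [Coalgebra k A]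

theorem conv_apply_eq_zero_of_mem_span (f g : WithConv (A →ₗ[k] A)) {x : A} {s : Set (A ⊗[k] A)}
    (hx : comul (R := k) x ∈ Submodule.span k s)
    (h : ∀ y ∈ s, TensorProduct.map f.ofConv g.ofConv y = 0) : (f * g) x = 0 := by
  rw [LinearMap.convMul_apply]
  have : Submodule.span k s ≤ LinearMap.ker (TensorProduct.map f.ofConv g.ofConv) :=
    Submodule.span_le.2 h
  rw [LinearMap.mem_ker.1 (this hx), map_zero]

/-- A connected graded coalgebra structure on an algebra, with group-like unit, has a homogeneous
convolution inverse of the identity. -/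
theorem exists_antipode_of_connected (b : Module.Basis κ k A) (deg : κ → ℕ)
    (hΔ : ∀ i, comul (R := k) (b i) ∈ Submodule.span k
      {y | ∃ j l, deg j + deg l = deg i ∧ y = b j ⊗ₜ[k] b l})
    (h_zero : ∀ i, deg i = 0 → b i = 1) (h_one : counit (R := k) (1 : A) = 1)
    (h_aug : ∀ i, deg i ≠ 0 → counit (R := k) (b i) = 0)
    (h_mul : ∀ j l, b j * b l ∈ Submodule.span k {x | ∃ i, deg i = deg j + deg l ∧ x = b i}) :
    ∃ S : A →ₗ[k] A,
      LinearMap.mul' k A ∘ₗ TensorProduct.map S LinearMap.id ∘ₗ comul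
        = Algebra.linearMap k A ∘ₗ counit ∧
      LinearMap.mul' k A ∘ₗ TensorProduct.map LinearMap.id S ∘ₗ comul
        = Algebra.linearMap k A ∘ₗ counit ∧
      ∀ i, S (b i) ∈ Submodule.span k {x | ∃ j, deg j = deg i ∧ x = b j} := by
  classical
  let G : ℕ → Submodule k A := fun m => Submodule.span k {x | ∃ j, deg j = m ∧ x = b j}
  let e : WithConv (A →ₗ[k] A) := toConv LinearMap.id
  let J : WithConv (A →ₗ[k] A) := 1 - e
  have hJ_apply : ∀ x, J x = algebraMap k A (counit x) - x := fun x => by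
    simp [J, e, LinearMap.convOne_def]
  have hJ_one : J 1 = 0 := by rw [hJ_apply, h_one, map_one, sub_self]
  have hmem : ∀ i, b i ∈ G (deg i) := fun i => Submodule.subset_span ⟨i, rfl, rfl⟩
  have hG_mul : ∀ {m m' : ℕ} {x y : A}, x ∈ G m → y ∈ G m' → x * y ∈ G (m + m') := by
    intro m m' x y hx hy
    have : G m * G m' ≤ G (m + m') := by
      rw [Submodule.span_mul_span, Submodule.span_le]
      rintro _ ⟨_, ⟨j, rfl, rfl⟩, _, ⟨l, rfl, rfl⟩, rfl⟩
      exact h_mul j l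
    exact this (Submodule.mul_mem_mul hx hy)
  have hone : ∀ i, deg i = 0 → (1 : A) ∈ G 0 := fun i hi => by
    rw [← h_zero i hi, ← hi]; exact hmem i
  have hcounit_mem : ∀ i, algebraMap k A (counit (b i)) ∈ G (deg i) := by
    intro i
    by_cases hi : deg i = 0
    · rw [Algebra.algebraMap_eq_smul_one, hi]
      exact Submodule.smul_mem _ _ (hone i hi)
    · rw [h_aug i hi, map_zero]
      exact Submodule.zero_mem _
  have hJ_mem : ∀ i, J (b i) ∈ G (deg i) := fun i => by
    rw [hJ_apply]
    exact Submodule.sub_mem _ (hcounit_mem i) (hmem i)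
  have hpow_mem : ∀ m i, (J ^ m) (b i) ∈ G (deg i) := by
    intro m
    induction m with
    | zero =>
      intro i
      rw [pow_zero, LinearMap.convOne_apply]
      exact hcounit_mem i
    | succ m ih =>
      intro i
      rw [pow_succ, LinearMap.convMul_apply]
      have : Submodule.span k {y | ∃ j l, deg j + deg l = deg i ∧ y = b j ⊗ₜ[k] b l}
          ≤ (G (deg i)).comap (LinearMap.mul' k A ∘ₗ TensorProduct.map (J ^ m).ofConv J.ofConv) := by
        rw [Submodule.span_le]
        rintro _ ⟨j, l, hjl, rfl⟩
        rw [← hjl]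
        exact hG_mul (ih j) (hJ_mem l)
      exact this (hΔ i)
  have hpow_zero : ∀ m i, deg i < m → (J ^ m) (b i) = 0 := by
    intro m
    induction m with
    | zero => intro i hi; omega
    | succ m ih =>
      intro i hi
      rw [pow_succ]
      refine conv_apply_eq_zero_of_mem_span _ _ (hΔ i) ?_
      rintro _ ⟨j, l, hjl, rfl⟩
      rw [TensorProduct.map_tmul]
      by_cases hl : deg l = 0
      · have : J.ofConv (b l) = 0 := by rw [h_zero l hl]; exact hJ_one
        rw [this, TensorProduct.tmul_zero]
      · have : (J ^ m).ofConv (b j) = 0 := ih j (by omega)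
        rw [this, TensorProduct.zero_tmul]
  let P : ℕ → WithConv (A →ₗ[k] A) := fun N => ∑ m ∈ Finset.range N, J ^ m
  have hP_succ : ∀ N, P (N + 1) = P N + J ^ N := fun N => Finset.sum_range_succ _ _
  have he : e = 1 - J := (sub_sub_cancel 1 e).symm
  have hPe : ∀ N, P N * e = 1 - J ^ N := fun N => by rw [he]; exact geom_sum_mul_neg J N
  have heP : ∀ N, e * P N = 1 - J ^ N := fun N => by rw [he]; exact mul_neg_geom_sum J N
  let S : A →ₗ[k] A := b.constr k fun i => P (deg i + 1) (b i)
  have hS : ∀ i, S (b i) = P (deg i + 1) (b i) := fun i => b.constr_basis k _ i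
  have hSP : ∀ N i, deg i ≤ N → S (b i) = P (N + 1) (b i) := by
    intro N i h
    induction N, h using Nat.le_induction with
    | base => exact hS i
    | succ N hN ih =>
      rw [ih, hP_succ (N + 1)]
      change _ = P (N + 1) (b i) + (J ^ (N + 1)) (b i)
      rw [hpow_zero _ _ (by omega), add_zero]
  have hfin : ∀ i, ((1 : WithConv (A →ₗ[k] A)) - J ^ (deg i + 1)) (b i)
      = algebraMap k A (counit (b i)) := by
    intro i
    change (1 : WithConv (A →ₗ[k] A)) (b i) - (J ^ (deg i + 1)) (b i) = _
    rw [hpow_zero _ _ (by omega), sub_zero, LinearMap.convOne_apply]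
  refine ⟨S, b.ext fun i => ?_, b.ext fun i => ?_, fun i => ?_⟩
  · have h : ((toConv S - P (deg i + 1)) * e) (b i) = 0 := by
      refine conv_apply_eq_zero_of_mem_span _ _ (hΔ i) ?_
      rintro _ ⟨j, l, hjl, rfl⟩
      have : (toConv S - P (deg i + 1)).ofConv (b j) = 0 :=
        sub_eq_zero.2 (hSP _ j (by omega))
      rw [TensorProduct.map_tmul, this, TensorProduct.zero_tmul]
    rw [sub_mul, hPe] at h
    exact (sub_eq_zero.1 h).trans (hfin i)
  · have h : (e * (toConv S - P (deg i + 1))) (b i) = 0 := by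
      refine conv_apply_eq_zero_of_mem_span _ _ (hΔ i) ?_
      rintro _ ⟨j, l, hjl, rfl⟩
      have : (toConv S - P (deg i + 1)).ofConv (b l) = 0 :=
        sub_eq_zero.2 (hSP _ l (by omega))
      rw [TensorProduct.map_tmul, this, TensorProduct.tmul_zero]
    rw [mul_sub, heP] at h
    exact (sub_eq_zero.1 h).trans (hfin i)
  · rw [hS]
    have : P (deg i + 1) (b i) = ∑ m ∈ Finset.range (deg i + 1), (J ^ m) (b i) := by
      change (P (deg i + 1)).ofConv (b i) = _
      simp only [P, WithConv.ofConv_sum, LinearMap.sum_apply]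
    rw [this]
    exact Submodule.sum_mem _ fun m _ => hpow_mem m i

end Antipode

section TensorPowers

variable {k M N P : Type*} [CommRing k] [AddCommGroup M] [Module k M] [AddCommGroup N] [Module k N]
  [AddCommGroup P] [Module k P]

theorem multilinear_mem_of_mem_span {ι : Type*} [Finite ι] (f : MultilinearMap k (fun _ : ι => M) P)
    (S : ι → Set M) (W : Submodule k P) (h : ∀ z : ι → M, (∀ i, z i ∈ S i) → f z ∈ W)
    (z : ι → M) (hz : ∀ i, z i ∈ Submodule.span k (S i)) : f z ∈ W := by
  classical
  have := Fintype.ofFinite ι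
  suffices H : ∀ (s : Finset ι) (z : ι → M), (∀ i ∈ s, z i ∈ Submodule.span k (S i)) →
      (∀ i ∉ s, z i ∈ S i) → f z ∈ W from
    H Finset.univ z (fun i _ => hz i) fun i hi => absurd (Finset.mem_univ i) hi
  intro s
  induction s using Finset.induction_on with
  | empty => exact fun z _ hz => h z fun i => hz i (Finset.notMem_empty i)
  | insert a s ha ih =>
    intro z hz hz'
    have key : Submodule.span k (S a) ≤ W.comap (f.toLinearMap z a) := by
      refine Submodule.span_le.2 fun x hx => ?_
      refine ih (Function.update z a x) (fun i hi => ?_) fun i hi => ?_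
      · rw [Function.update_of_ne (ne_of_mem_of_not_mem hi ha)]
        exact hz i (Finset.mem_insert_of_mem hi)
      · by_cases hia : i = a
        · subst hia
          rwa [Function.update_self]
        · rw [Function.update_of_ne hia]
          exact hz' i fun h => (Finset.mem_insert.1 h).elim hia hi
    have := key (hz a (Finset.mem_insert_self a s))
    rwa [Submodule.mem_comap, MultilinearMap.toLinearMap_apply, Function.update_eq_self] at this

theorem tensorPower_hom_ext {n : ℕ} {S : Set M} (hS : Submodule.span k S = ⊤)
    {L L' : (⨂[k]^n M) →ₗ[k] P}
    (h : ∀ z : Fin n → M, (∀ i, z i ∈ S) → L (tprod k z) = L' (tprod k z)) : L = L' := by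
  refine PiTensorProduct.ext (MultilinearMap.ext fun z => ?_)
  have := multilinear_mem_of_mem_span ((L - L').compMultilinearMap (tprod k)) (fun _ => S) ⊥
    (fun z hz => by simp [h z hz]) z (fun i => hS ▸ Submodule.mem_top)
  simpa [sub_eq_zero] using this

theorem tensorPower_tmul_hom_ext {n : ℕ} {L L' : (⨂[k]^n (M ⊗[k] N)) →ₗ[k] P}
    (h : ∀ (a : Fin n → M) (b : Fin n → N),
      L (tprod k fun i => a i ⊗ₜ[k] b i) = L' (tprod k fun i => a i ⊗ₜ[k] b i)) : L = L' := by
  refine tensorPower_hom_ext (TensorProduct.span_tmul_eq_top k M N) fun z hz => ?_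
  choose a b hab using hz
  obtain rfl : (fun i => a i ⊗ₜ[k] b i) = z := funext hab
  exact h a b

theorem exists_tensorPower_shuffle₃ {κ : Type*} {n : ℕ} (b : Module.Basis κ k M) :
    ∃ ρ : (⨂[k]^n (M ⊗[k] (M ⊗[k] M))) →ₗ[k] (⨂[k]^n M) ⊗[k] ((⨂[k]^n M) ⊗[k] (⨂[k]^n M)),
      ∀ x y z : Fin n → κ, ρ (tprod k fun i => b (x i) ⊗ₜ[k] (b (y i) ⊗ₜ[k] b (z i)))
        = (tprod k fun i => b (x i)) ⊗ₜ[k]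
          ((tprod k fun i => b (y i)) ⊗ₜ[k] (tprod k fun i => b (z i))) := by
  refine ⟨(Basis.piTensorProduct fun _ : Fin n => b.tensorProduct (b.tensorProduct b)).constr k
    fun p => (tprod k fun i => b (p i).1) ⊗ₜ[k]
      ((tprod k fun i => b (p i).2.1) ⊗ₜ[k] (tprod k fun i => b (p i).2.2)), fun x y z => ?_⟩
  have := (Basis.piTensorProduct fun _ : Fin n => b.tensorProduct (b.tensorProduct b)).constr_basis k
    (fun p => (tprod k fun i => b (p i).1) ⊗ₜ[k]
      ((tprod k fun i => b (p i).2.1) ⊗ₜ[k] (tprod k fun i => b (p i).2.2)))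
    (fun i => (x i, y i, z i))
  simpa [Basis.piTensorProduct_apply] using this

theorem span_tmul_basis {κ : Type*} (b : Module.Basis κ k M) :
    Submodule.span k {x : M ⊗[k] M | ∃ i j, x = b i ⊗ₜ[k] b j} = ⊤ := by
  rw [← (b.tensorProduct b).span_eq]
  congr 1
  ext x
  simp [Module.Basis.tensorProduct_apply', eq_comm]

/-- A linear map `⨂^n (M ⊗ M) → ⨂^n M ⊗ ⨂^n M` separating the two tensor factors turns a
coassociative map on `M` into a coassociative map on `⨂^n M`. -/
theorem tensorPower_coassoc {κ : Type*} {n : ℕ} (b : Module.Basis κ k M)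
    (τ : (⨂[k]^n (M ⊗[k] M)) →ₗ[k] (⨂[k]^n M) ⊗[k] (⨂[k]^n M))
    (hτ : ∀ x y : Fin n → M,
      τ (tprod k fun i => x i ⊗ₜ[k] y i) = (tprod k x) ⊗ₜ[k] (tprod k y))
    (Δ : M →ₗ[k] M ⊗[k] M) (x : Fin n → M)
    (hx : ∀ i, TensorProduct.assoc k M M M (TensorProduct.map Δ LinearMap.id (Δ (x i)))
      = TensorProduct.map LinearMap.id Δ (Δ (x i))) :
    TensorProduct.assoc k _ _ _ (TensorProduct.map (τ ∘ₗ PiTensorProduct.map fun _ => Δ)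
        LinearMap.id (τ (PiTensorProduct.map (fun _ => Δ) (tprod k x))))
      = TensorProduct.map LinearMap.id (τ ∘ₗ PiTensorProduct.map fun _ => Δ)
        (τ (PiTensorProduct.map (fun _ => Δ) (tprod k x))) := by
  obtain ⟨ρ, hρ⟩ := exists_tensorPower_shuffle₃ (n := n) b
  have hspan := span_tmul_basis b
  have left : (TensorProduct.assoc k _ _ _).toLinearMap
        ∘ₗ TensorProduct.map (τ ∘ₗ PiTensorProduct.map fun _ => Δ) LinearMap.id ∘ₗ τ
      = ρ ∘ₗ PiTensorProduct.map fun _ => (TensorProduct.assoc k M M M).toLinearMap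
        ∘ₗ TensorProduct.map Δ LinearMap.id := by
    refine tensorPower_hom_ext hspan fun z hz => ?_
    choose u v huv using hz
    obtain rfl := funext huv
    have aux : (TensorProduct.assoc k _ _ _).toLinearMap
          ∘ₗ (TensorProduct.mk k _ _).flip (tprod k fun i => b (v i)) ∘ₗ τ
        = ρ ∘ₗ PiTensorProduct.map fun i => (TensorProduct.assoc k M M M).toLinearMap
          ∘ₗ (TensorProduct.mk k _ _).flip (b (v i)) := by
      refine tensorPower_hom_ext hspan fun z hz => ?_
      choose c d hcd using hz
      obtain rfl := funext hcd
      simp [hτ, hρ]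
    have := LinearMap.congr_fun aux (tprod k fun i => Δ (b (u i)))
    simpa [hτ] using this
  have right : TensorProduct.map LinearMap.id (τ ∘ₗ PiTensorProduct.map fun _ => Δ) ∘ₗ τ
      = ρ ∘ₗ PiTensorProduct.map fun _ => TensorProduct.map LinearMap.id Δ := by
    refine tensorPower_hom_ext hspan fun z hz => ?_
    choose u v huv using hz
    obtain rfl := funext huv
    have aux : TensorProduct.mk k _ _ (tprod k fun i => b (u i)) ∘ₗ τ
        = ρ ∘ₗ PiTensorProduct.map fun i => TensorProduct.mk k _ _ (b (u i)) := by
      refine tensorPower_hom_ext hspan fun z hz => ?_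
      choose c d hcd using hz
      obtain rfl := funext hcd
      simp [hτ, hρ]
    have := LinearMap.congr_fun aux (tprod k fun i => Δ (b (v i)))
    simpa [hτ] using this
  have hl := LinearMap.congr_fun left (tprod k fun i => Δ (x i))
  have hr := LinearMap.congr_fun right (tprod k fun i => Δ (x i))
  simp only [LinearMap.comp_apply, PiTensorProduct.map_tprod, LinearEquiv.coe_coe] at hl hr ⊢
  rw [hl, hr]
  simp only [hx]

end TensorPowers

section FreeAlgebra

variable {n : ℕ}

/-- Recursion on planar trees with values in a monoid, extended multiplicatively to words. -/
noncomputable def graftRec {M : Type*} [Monoid M] (Φ : (Fin n → M) → M) (t : PlTree n) : M :=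
  Φ fun i => ((children t i).attach.map fun s => graftRec Φ s.1).prod
  termination_by tsize t
  decreasing_by exact tsize_lt_of_mem_children s.2

theorem graftRec_pgraftW {M : Type*} [Monoid M] (Φ : (Fin n → M) → M)
    (g : Fin n → List (PlTree n)) :
    graftRec Φ (pgraftW g) = Φ fun i => ((g i).map (graftRec Φ)).prod := by
  rw [graftRec]
  congr 1
  funext i
  have h := congrArg (List.map (graftRec Φ)) (List.attach_map_subtype_val (children (pgraftW g) i))
  rw [List.map_map] at h
  exact congrArg List.prod (h.trans (by rw [children_pgraftW]))

variable (k : Type) [CommRing k]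

theorem wmon_nil : wmon k ([] : List (PlTree n)) = 1 := rfl

theorem wmon_singleton (t : PlTree n) : wmon k [t] = FreeAlgebra.ι k t := by simp [wmon]

theorem wmon_cons (t : PlTree n) (w : List (PlTree n)) :
    wmon k (t :: w) = FreeAlgebra.ι k t * wmon k w := by simp [wmon]

theorem wmon_append (v w : List (PlTree n)) : wmon k (v ++ w) = wmon k v * wmon k w := by
  simp [wmon]

theorem wmon_flatten (L : List (List (PlTree n))) :
    wmon k L.flatten = (L.map (wmon k)).prod := by
  induction L with
  | nil => rfl
  | cons a L ih => simp [wmon_append, ih]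

/-- The basis of words of planar trees. -/
noncomputable def wordBasis (n : ℕ) : Module.Basis (List (PlTree n)) k (FreeAlgebra k (PlTree n)) :=
  FreeAlgebra.basisFreeMonoid k (PlTree n)

theorem wordBasis_apply (w : List (PlTree n)) : wordBasis k n w = wmon k w := by
  have h : wordBasis k n w
      = FreeAlgebra.equivMonoidAlgebraFreeMonoid.symm
        (MonoidAlgebra.single (FreeMonoid.ofList w) 1) := by
    simp [wordBasis, FreeAlgebra.basisFreeMonoid]
    rfl
  rw [h]
  simp [FreeAlgebra.equivMonoidAlgebraFreeMonoid, wmon]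

theorem span_range_wmon : Submodule.span k (Set.range (wmon k (n := n))) = ⊤ := by
  rw [← (wordBasis k n).span_eq]
  congr 2
  exact funext fun w => (wordBasis_apply k w).symm

variable {k}

theorem map_wmon_eq {B : Type*} [Semiring B] [Algebra k B] (f : FreeAlgebra k (PlTree n) →ₐ[k] B)
    (w : List (PlTree n)) : f (wmon k w) = (w.map fun t => f (FreeAlgebra.ι k t)).prod := by
  simp [wmon, map_list_prod, Function.comp_def]

theorem algHom_ext_graft {B : Type*} [Semiring B] [Algebra k B]
    {f f' : FreeAlgebra k (PlTree n) →ₐ[k] B}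
    (h : ∀ g : Fin n → List (PlTree n), (∀ i, f (wmon k (g i)) = f' (wmon k (g i))) →
      f (FreeAlgebra.ι k (pgraftW g)) = f' (FreeAlgebra.ι k (pgraftW g))) : f = f' := by
  refine FreeAlgebra.hom_ext (funext fun t => ?_)
  induction t using PlTree.graft_induction with
  | h g ih =>
    refine h g fun i => ?_
    rw [map_wmon_eq, map_wmon_eq]
    exact congrArg List.prod (List.map_congr_left fun s hs => ih i s hs)

/-- The graded endomorphism multiplying a tree by a scalar to the power of its size. -/
noncomputable def scaleHom (n : ℕ) (c : k) :
    FreeAlgebra k (PlTree n) →ₐ[k] FreeAlgebra k (PlTree n) :=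
  FreeAlgebra.lift k fun t => c ^ tsize t • FreeAlgebra.ι k t

theorem scaleHom_ι (c : k) (t : PlTree n) :
    scaleHom n c (FreeAlgebra.ι k t) = c ^ tsize t • FreeAlgebra.ι k t := by simp [scaleHom]

theorem scaleHom_wmon (c : k) (w : List (PlTree n)) :
    scaleHom n c (wmon k w) = c ^ wsize w • wmon k w := by
  induction w with
  | nil => simp [wmon_nil, wsize_nil]
  | cons t w ih =>
    rw [wmon_cons, map_mul, ih, scaleHom_ι, wsize_cons, pow_add, smul_mul_smul_comm]

theorem augA_wmon (w : List (PlTree n)) : augA k n (wmon k w) = if w = [] then 1 else 0 := by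
  cases w with
  | nil => simp [wmon_nil]
  | cons t w => simp [wmon_cons, augA]

theorem augA_ι (t : PlTree n) : augA k n (FreeAlgebra.ι k t) = 0 := by simp [augA]

theorem augA_comp_scaleHom (c : k) : (augA k n).comp (scaleHom n c) = augA k n :=
  FreeAlgebra.hom_ext (funext fun t => by simp [scaleHom_ι, augA_ι])

/-- The product of the tensor factors, each rescaled according to size. -/
noncomputable def sigmaHom (c : Fin n → k) :
    (⨂[k]^n (FreeAlgebra k (PlTree n))) →ₗ[k] FreeAlgebra k (PlTree n) :=
  PiTensorProduct.lift ((MultilinearMap.mkPiAlgebraFin k n (FreeAlgebra k (PlTree n))).compLinearMap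
    fun j => (scaleHom n (c j)).toLinearMap)

theorem sigmaHom_tprod (c : Fin n → k) (a : Fin n → FreeAlgebra k (PlTree n)) :
    sigmaHom c (tprod k a) = (List.ofFn fun j => scaleHom n (c j) (a j)).prod := by
  simp [sigmaHom]

theorem sigmaHom_tprod_wmon (c : Fin n → k) (g : Fin n → List (PlTree n)) :
    sigmaHom c (tprod k fun j => wmon k (g j))
      = (∏ j, c j ^ wsize (g j)) • wmon k (List.ofFn g).flatten := by
  rw [sigmaHom_tprod, wmon_flatten, List.map_ofFn]
  simp only [scaleHom_wmon]
  have := (MultilinearMap.mkPiAlgebraFin k n (FreeAlgebra k (PlTree n))).map_smul_univ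
    (fun j => c j ^ wsize (g j)) fun j => wmon k (g j)
  simpa [Function.comp_def] using this

theorem augA_sigmaHom (c : Fin n → k) (a : Fin n → FreeAlgebra k (PlTree n)) :
    augA k n (sigmaHom c (tprod k a)) = ∏ j, augA k n (a j) := by
  have h : ∀ d x, augA k n (scaleHom n d x) = augA k n x := fun d x =>
    DFunLike.congr_fun (augA_comp_scaleHom d) x
  rw [sigmaHom_tprod, map_list_prod, List.map_ofFn, List.prod_ofFn]
  exact Finset.prod_congr rfl fun j _ => h _ _

/-- The degree `m` part of the tensor square. -/
def gradedTensor (k : Type) [CommRing k] (n m : ℕ) :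
    Submodule k (FreeAlgebra k (PlTree n) ⊗[k] FreeAlgebra k (PlTree n)) :=
  Submodule.span k {y | ∃ a b : List (PlTree n), wsize a + wsize b = m ∧
    y = wmon k a ⊗ₜ[k] wmon k b}

theorem tmul_mem_gradedTensor {m : ℕ} {a b : List (PlTree n)} (h : wsize a + wsize b = m) :
    wmon k a ⊗ₜ[k] wmon k b ∈ gradedTensor k n m :=
  Submodule.subset_span ⟨a, b, h, rfl⟩

theorem mul_mem_gradedTensor {m m' : ℕ}
    {x y : FreeAlgebra k (PlTree n) ⊗[k] FreeAlgebra k (PlTree n)}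
    (hx : x ∈ gradedTensor k n m) (hy : y ∈ gradedTensor k n m') :
    x * y ∈ gradedTensor k n (m + m') := by
  have : gradedTensor k n m * gradedTensor k n m' ≤ gradedTensor k n (m + m') := by
    rw [gradedTensor, gradedTensor, Submodule.span_mul_span, Submodule.span_le]
    rintro _ ⟨_, ⟨a, b, rfl, rfl⟩, _, ⟨c, d, rfl, rfl⟩, rfl⟩
    dsimp only
    rw [Algebra.TensorProduct.tmul_mul_tmul, ← wmon_append, ← wmon_append]
    exact tmul_mem_gradedTensor (by simp only [wsize_append]; omega)
  exact this (Submodule.mul_mem_mul hx hy)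

theorem map_wmon_mem_gradedTensor
    (Δ : FreeAlgebra k (PlTree n) →ₐ[k] FreeAlgebra k (PlTree n) ⊗[k] FreeAlgebra k (PlTree n))
    (w : List (PlTree n))
    (h : ∀ t ∈ w, Δ (FreeAlgebra.ι k t) ∈ gradedTensor k n (tsize t)) :
    Δ (wmon k w) ∈ gradedTensor k n (wsize w) := by
  induction w with
  | nil =>
    rw [wmon_nil, map_one, Algebra.TensorProduct.one_def, ← wmon_nil]
    exact tmul_mem_gradedTensor rfl
  | cons t w ih =>
    rw [wmon_cons, map_mul, wsize_cons]
    exact mul_mem_gradedTensor (h t List.mem_cons_self)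
      (ih fun s hs => h s (List.mem_cons_of_mem _ hs))

theorem map_scaleHom_of_mem_gradedTensor (c : k) {m : ℕ}
    {x : FreeAlgebra k (PlTree n) ⊗[k] FreeAlgebra k (PlTree n)} (hx : x ∈ gradedTensor k n m) :
    Algebra.TensorProduct.map (scaleHom n c) (scaleHom n c) x = c ^ m • x := by
  induction hx using Submodule.span_induction with
  | mem x hx =>
    obtain ⟨a, b, rfl, rfl⟩ := hx
    rw [Algebra.TensorProduct.map_tmul, scaleHom_wmon, scaleHom_wmon,
      TensorProduct.smul_tmul_smul, pow_add]
  | zero => simp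
  | add x y _ _ hx hy => rw [map_add, hx, hy, smul_add]
  | smul r x _ hx => rw [map_smul, hx, smul_comm]

theorem comp_scaleHom_of_graded
    (Δ : FreeAlgebra k (PlTree n) →ₐ[k] FreeAlgebra k (PlTree n) ⊗[k] FreeAlgebra k (PlTree n))
    (hΔ : ∀ t, Δ (FreeAlgebra.ι k t) ∈ gradedTensor k n (tsize t)) (c : k) :
    Δ.comp (scaleHom n c)
      = (Algebra.TensorProduct.map (scaleHom n c) (scaleHom n c)).comp Δ := by
  refine FreeAlgebra.hom_ext (funext fun t => ?_)
  simp [scaleHom_ι, map_scaleHom_of_mem_gradedTensor c (hΔ t)]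

end FreeAlgebra

section Coproduct

variable {k : Type} [CommRing k] {n : ℕ}
  (lam : (⨂[k]^n (FreeAlgebra k (PlTree n))) →ₗ[k] FreeAlgebra k (PlTree n))
  (τ : (⨂[k]^n (FreeAlgebra k (PlTree n) ⊗[k] FreeAlgebra k (PlTree n))) →ₗ[k]
    (⨂[k]^n (FreeAlgebra k (PlTree n))) ⊗[k] (⨂[k]^n (FreeAlgebra k (PlTree n))))
  (q : Fin 2 → Fin n → k)

/-- The map `(σ₁ ⊗ λ + λ ⊗ σ₂) ∘ τ` giving the coproduct of a grafting. -/
noncomputable def graftCop :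
    (⨂[k]^n (FreeAlgebra k (PlTree n) ⊗[k] FreeAlgebra k (PlTree n))) →ₗ[k]
      FreeAlgebra k (PlTree n) ⊗[k] FreeAlgebra k (PlTree n) :=
  (TensorProduct.map (sigmaHom (q 0)) lam + TensorProduct.map lam (sigmaHom (q 1))) ∘ₗ τ

/-- The coproduct on `A_n` attached to the parameters `q`. -/
noncomputable def coproduct :
    FreeAlgebra k (PlTree n) →ₐ[k] FreeAlgebra k (PlTree n) ⊗[k] FreeAlgebra k (PlTree n) :=
  FreeAlgebra.lift k (graftRec fun z => graftCop lam τ q (tprod k z))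

theorem coproduct_ι_pgraftW (g : Fin n → List (PlTree n)) :
    coproduct lam τ q (FreeAlgebra.ι k (pgraftW g))
      = graftCop lam τ q (tprod k fun i => coproduct lam τ q (wmon k (g i))) := by
  rw [coproduct, FreeAlgebra.lift_ι_apply, graftRec_pgraftW]
  simp only [map_wmon_eq, FreeAlgebra.lift_ι_apply]

variable {lam τ}
variable (hlam : ∀ g : Fin n → List (PlTree n),
    lam (tprod k fun i => wmon k (g i)) = FreeAlgebra.ι k (pgraftW g))
  (hτ : ∀ a b : Fin n → FreeAlgebra k (PlTree n),
    τ (tprod k fun i => a i ⊗ₜ[k] b i) = (tprod k a) ⊗ₜ[k] (tprod k b))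

include hlam in
theorem coproduct_comp_graft :
    (coproduct lam τ q).toLinearMap ∘ₗ lam
      = graftCop lam τ q ∘ₗ PiTensorProduct.map fun _ => (coproduct lam τ q).toLinearMap := by
  refine tensorPower_hom_ext (span_range_wmon k) fun z hz => ?_
  choose g hg using hz
  obtain rfl := funext hg
  rw [LinearMap.comp_apply, hlam, LinearMap.comp_apply, PiTensorProduct.map_tprod]
  exact coproduct_ι_pgraftW lam τ q g

include hlam hτ in
theorem coproduct_ι_mem (t : PlTree n) :
    coproduct lam τ q (FreeAlgebra.ι k t) ∈ gradedTensor k n (tsize t) := by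
  induction t using PlTree.graft_induction with
  | h g ih =>
    rw [coproduct_ι_pgraftW]
    refine multilinear_mem_of_mem_span ((graftCop lam τ q).compMultilinearMap (tprod k))
      (fun i => {y | ∃ a b : List (PlTree n), wsize a + wsize b = wsize (g i) ∧
        y = wmon k a ⊗ₜ[k] wmon k b}) _ (fun z hz => ?_) _
      fun i => map_wmon_mem_gradedTensor _ _ (ih i)
    choose a b hab hz using hz
    obtain rfl : (fun i => wmon k (a i) ⊗ₜ[k] wmon k (b i)) = z := (funext hz).symm
    have hsum : ∑ i, wsize (a i) + ∑ i, wsize (b i) = ∑ i, wsize (g i) := by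
      rw [← Finset.sum_add_distrib]
      exact Finset.sum_congr rfl fun i _ => hab i
    simp only [LinearMap.compMultilinearMap_apply, graftCop, LinearMap.comp_apply, hτ,
      LinearMap.add_apply, TensorProduct.map_tmul, sigmaHom_tprod_wmon, hlam,
      ← wmon_singleton, TensorProduct.tmul_smul, ← TensorProduct.smul_tmul']
    refine Submodule.add_mem _ (Submodule.smul_mem _ _ ?_) (Submodule.smul_mem _ _ ?_) <;>
    · refine tmul_mem_gradedTensor ?_
      rw [wsize_flatten, wsize_singleton, tsize_pgraftW, tsize_pgraftW]
      omega

include hτ in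
theorem map_sigmaHom_comp (c : Fin n → k)
    (z : Fin n → FreeAlgebra k (PlTree n) ⊗[k] FreeAlgebra k (PlTree n)) :
    TensorProduct.map (sigmaHom c) (sigmaHom c) (τ (tprod k z))
      = (List.ofFn fun j =>
          Algebra.TensorProduct.map (scaleHom n (c j)) (scaleHom n (c j)) (z j)).prod := by
  have h : TensorProduct.map (sigmaHom c) (sigmaHom c) ∘ₗ τ
      = PiTensorProduct.lift ((MultilinearMap.mkPiAlgebraFin k n _).compLinearMap fun j =>
          (Algebra.TensorProduct.map (scaleHom n (c j)) (scaleHom n (c j))).toLinearMap) := by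
    refine tensorPower_tmul_hom_ext fun a b => ?_
    have hprod : ∀ L : List (FreeAlgebra k (PlTree n) × FreeAlgebra k (PlTree n)),
        (L.map fun p => p.1 ⊗ₜ[k] p.2).prod
          = (L.map Prod.fst).prod ⊗ₜ[k] (L.map Prod.snd).prod := by
      intro L
      induction L with
      | nil => rfl
      | cons p L ih => simp [ih]
    have := hprod (List.ofFn fun j => (scaleHom n (c j) (a j), scaleHom n (c j) (b j)))
    simp only [List.map_ofFn, Function.comp_def] at this
    simp [hτ, sigmaHom_tprod, this]
  refine (LinearMap.congr_fun h (tprod k z)).trans ?_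
  rw [PiTensorProduct.lift.tprod]
  rfl

include hlam hτ in
theorem coproduct_sigmaHom (c : Fin n → k) :
    (coproduct lam τ q).toLinearMap ∘ₗ sigmaHom c
      = TensorProduct.map (sigmaHom c) (sigmaHom c) ∘ₗ τ
        ∘ₗ PiTensorProduct.map fun _ => (coproduct lam τ q).toLinearMap := by
  refine PiTensorProduct.ext (MultilinearMap.ext fun a => ?_)
  have h : ∀ d x, coproduct lam τ q (scaleHom n d x)
      = Algebra.TensorProduct.map (scaleHom n d) (scaleHom n d) (coproduct lam τ q x) :=
    fun d x => DFunLike.congr_fun (comp_scaleHom_of_graded _ (coproduct_ι_mem q hlam hτ) d) x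
  simp [map_sigmaHom_comp hτ, sigmaHom_tprod, map_list_prod, List.map_ofFn, Function.comp_def, h]

include hlam hτ in
theorem coproduct_coassoc :
    (TensorProduct.assoc k _ _ _).toLinearMap
        ∘ₗ TensorProduct.map (coproduct lam τ q).toLinearMap LinearMap.id
        ∘ₗ (coproduct lam τ q).toLinearMap
      = TensorProduct.map LinearMap.id (coproduct lam τ q).toLinearMap
        ∘ₗ (coproduct lam τ q).toLinearMap := by
  set Δ := coproduct lam τ q with hΔ
  suffices h : ((Algebra.TensorProduct.assoc k k k _ _ _).toAlgHom.comp
      (Algebra.TensorProduct.map Δ (AlgHom.id k _))).comp Δ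
      = (Algebra.TensorProduct.map (AlgHom.id k _) Δ).comp Δ from
    LinearMap.ext fun x => DFunLike.congr_fun h x
  refine algHom_ext_graft fun g ih => ?_
  set x : Fin n → FreeAlgebra k (PlTree n) := fun i => wmon k (g i) with hx
  set δ := τ ∘ₗ PiTensorProduct.map fun _ => Δ.toLinearMap with hδ
  have hδx : TensorProduct.assoc k _ _ _ (TensorProduct.map δ LinearMap.id (δ (tprod k x)))
      = TensorProduct.map LinearMap.id δ (δ (tprod k x)) :=
    tensorPower_coassoc (wordBasis k n) τ hτ Δ.toLinearMap x ih
  have hΔι : Δ (FreeAlgebra.ι k (pgraftW g))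
      = TensorProduct.map (sigmaHom (q 0)) lam (δ (tprod k x))
        + TensorProduct.map lam (sigmaHom (q 1)) (δ (tprod k x)) := by
    rw [hΔ, coproduct_ι_pgraftW]
    simp [graftCop, hδ, hx, hΔ]
  have hlamΔ : Δ.toLinearMap ∘ₗ lam = (TensorProduct.map (sigmaHom (q 0)) lam
      + TensorProduct.map lam (sigmaHom (q 1))) ∘ₗ δ := coproduct_comp_graft q hlam
  have hσ : ∀ i, Δ.toLinearMap ∘ₗ sigmaHom (q i)
      = TensorProduct.map (sigmaHom (q i)) (sigmaHom (q i)) ∘ₗ δ := fun i =>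
    coproduct_sigmaHom q hlam hτ (q i)
  change TensorProduct.assoc k _ _ _ (TensorProduct.map Δ.toLinearMap LinearMap.id (Δ _))
    = TensorProduct.map LinearMap.id Δ.toLinearMap (Δ _)
  have e₁ : ∀ (u v : (⨂[k]^n (FreeAlgebra k (PlTree n))) →ₗ[k] FreeAlgebra k (PlTree n)) y,
      TensorProduct.map Δ.toLinearMap LinearMap.id (TensorProduct.map u v y)
        = TensorProduct.map (Δ.toLinearMap ∘ₗ u) v y := fun u v y => by
    rw [← LinearMap.comp_apply, ← TensorProduct.map_comp, LinearMap.id_comp]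
  have e₂ : ∀ (u v : (⨂[k]^n (FreeAlgebra k (PlTree n))) →ₗ[k] FreeAlgebra k (PlTree n)) y,
      TensorProduct.map LinearMap.id Δ.toLinearMap (TensorProduct.map u v y)
        = TensorProduct.map u (Δ.toLinearMap ∘ₗ v) y := fun u v y => by
    rw [← LinearMap.comp_apply, ← TensorProduct.map_comp, LinearMap.id_comp]
  have e₃ : ∀ (u v w : (⨂[k]^n (FreeAlgebra k (PlTree n))) →ₗ[k] FreeAlgebra k (PlTree n)) y,
      TensorProduct.assoc k _ _ _ (TensorProduct.map (TensorProduct.map u v ∘ₗ δ) w y)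
        = TensorProduct.map u (TensorProduct.map v w)
          (TensorProduct.assoc k _ _ _ (TensorProduct.map δ LinearMap.id y)) := fun u v w y => by
    have h₁ : TensorProduct.map (TensorProduct.map u v ∘ₗ δ) w
        = TensorProduct.map (TensorProduct.map u v) w ∘ₗ TensorProduct.map δ LinearMap.id := by
      rw [← TensorProduct.map_comp, LinearMap.comp_id]
    rw [h₁, LinearMap.comp_apply]
    exact (LinearMap.congr_fun (TensorProduct.map_map_comp_assoc_eq u v w) _).symm
  have e₄ : ∀ (u v w : (⨂[k]^n (FreeAlgebra k (PlTree n))) →ₗ[k] FreeAlgebra k (PlTree n)) y,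
      TensorProduct.map u (TensorProduct.map v w ∘ₗ δ) y
        = TensorProduct.map u (TensorProduct.map v w)
          (TensorProduct.map LinearMap.id δ y) := fun u v w y => by
    rw [← LinearMap.comp_apply, ← TensorProduct.map_comp, LinearMap.comp_id]
  rw [hΔι]
  simp only [map_add, e₁, e₂, hlamΔ, hσ, LinearMap.add_comp, TensorProduct.map_add_left,
    TensorProduct.map_add_right, LinearMap.add_apply, e₃, e₄, hδx]
  abel

include hlam in
theorem augA_comp_graft : (augA k n).toLinearMap ∘ₗ lam = 0 := by
  refine tensorPower_hom_ext (span_range_wmon k) fun z hz => ?_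
  choose g hg using hz
  obtain rfl := funext hg
  rw [LinearMap.comp_apply, hlam]
  exact augA_ι _

include hlam hτ in
theorem coproduct_counit_left :
    (TensorProduct.lid k _).toLinearMap
        ∘ₗ TensorProduct.map (augA k n).toLinearMap LinearMap.id
        ∘ₗ (coproduct lam τ q).toLinearMap = LinearMap.id := by
  suffices h : ((Algebra.TensorProduct.lid k _).toAlgHom.comp
      (Algebra.TensorProduct.map (augA k n) (AlgHom.id k _))).comp (coproduct lam τ q)
      = AlgHom.id k _ from LinearMap.ext fun x => DFunLike.congr_fun h x
  refine algHom_ext_graft fun g ih => ?_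
  have h_aug : ∀ y, augA k n (lam y) = 0 := fun y => LinearMap.congr_fun (augA_comp_graft hlam) y
  have key : (TensorProduct.lid k _).toLinearMap
        ∘ₗ TensorProduct.map (augA k n).toLinearMap LinearMap.id ∘ₗ graftCop lam τ q
      = lam ∘ₗ PiTensorProduct.map fun _ => (TensorProduct.lid k _).toLinearMap
        ∘ₗ TensorProduct.map (augA k n).toLinearMap LinearMap.id := by
    refine tensorPower_tmul_hom_ext fun a b => ?_
    have := (PiTensorProduct.tprod k).map_smul_univ (fun i => augA k n (a i)) b
    simp [graftCop, hτ, augA_sigmaHom, h_aug, this]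
  have := LinearMap.congr_fun key (tprod k fun i => coproduct lam τ q (wmon k (g i)))
  rw [LinearMap.comp_apply, LinearMap.comp_apply, ← coproduct_ι_pgraftW, LinearMap.comp_apply,
    PiTensorProduct.map_tprod] at this
  refine this.trans ?_
  rw [AlgHom.id_apply, ← hlam]
  exact congrArg (fun z => lam (tprod k z)) (funext ih)

include hlam hτ in
theorem coproduct_counit_right :
    (TensorProduct.rid k _).toLinearMap
        ∘ₗ TensorProduct.map LinearMap.id (augA k n).toLinearMap
        ∘ₗ (coproduct lam τ q).toLinearMap = LinearMap.id := by
  suffices h : ((Algebra.TensorProduct.rid k k _).toAlgHom.comp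
      (Algebra.TensorProduct.map (AlgHom.id k _) (augA k n))).comp (coproduct lam τ q)
      = AlgHom.id k _ from LinearMap.ext fun x => DFunLike.congr_fun h x
  refine algHom_ext_graft fun g ih => ?_
  have h_aug : ∀ y, augA k n (lam y) = 0 := fun y => LinearMap.congr_fun (augA_comp_graft hlam) y
  have key : (TensorProduct.rid k _).toLinearMap
        ∘ₗ TensorProduct.map LinearMap.id (augA k n).toLinearMap ∘ₗ graftCop lam τ q
      = lam ∘ₗ PiTensorProduct.map fun _ => (TensorProduct.rid k _).toLinearMap
        ∘ₗ TensorProduct.map LinearMap.id (augA k n).toLinearMap := by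
    refine tensorPower_tmul_hom_ext fun a b => ?_
    have := (PiTensorProduct.tprod k).map_smul_univ (fun i => augA k n (b i)) a
    simp [graftCop, hτ, augA_sigmaHom, h_aug, this]
  have := LinearMap.congr_fun key (tprod k fun i => coproduct lam τ q (wmon k (g i)))
  rw [LinearMap.comp_apply, LinearMap.comp_apply, ← coproduct_ι_pgraftW, LinearMap.comp_apply,
    PiTensorProduct.map_tprod] at this
  refine this.trans ?_
  rw [AlgHom.id_apply, ← hlam]
  exact congrArg (fun z => lam (tprod k z)) (funext ih)

include hlam hτ in
theorem coproduct_wmon_mem (w : List (PlTree n)) :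
    coproduct lam τ q (wmon k w) ∈ gradedTensor k n (wsize w) :=
  map_wmon_mem_gradedTensor _ _ fun t _ => coproduct_ι_mem q hlam hτ t

include hlam hτ in
theorem exists_antipode_coproduct :
    ∃ S : FreeAlgebra k (PlTree n) →ₗ[k] FreeAlgebra k (PlTree n),
      LinearMap.mul' k _ ∘ₗ TensorProduct.map S LinearMap.id ∘ₗ (coproduct lam τ q).toLinearMap
        = Algebra.linearMap k _ ∘ₗ (augA k n).toLinearMap ∧
      LinearMap.mul' k _ ∘ₗ TensorProduct.map LinearMap.id S ∘ₗ (coproduct lam τ q).toLinearMap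
        = Algebra.linearMap k _ ∘ₗ (augA k n).toLinearMap ∧
      ∀ w : List (PlTree n), S (wmon k w) ∈ Submodule.span k
        {x | ∃ v : List (PlTree n), wsize v = wsize w ∧ x = wmon k v} := by
  let _ : Coalgebra k (FreeAlgebra k (PlTree n)) :=
    { comul := (coproduct lam τ q).toLinearMap
      counit := (augA k n).toLinearMap
      coassoc := coproduct_coassoc q hlam hτ
      rTensor_counit_comp_comul := LinearMap.ext fun x =>
        (TensorProduct.lid k _).injective <| by
          simpa [LinearMap.rTensor] using LinearMap.congr_fun (coproduct_counit_left q hlam hτ) x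
      lTensor_counit_comp_comul := LinearMap.ext fun x =>
        (TensorProduct.rid k _).injective <| by
          simpa [LinearMap.lTensor] using LinearMap.congr_fun (coproduct_counit_right q hlam hτ) x }
  have := exists_antipode_of_connected (wordBasis k n) wsize
    (fun w => by
      simp only [wordBasis_apply]
      exact coproduct_wmon_mem q hlam hτ w)
    (fun w hw => by rw [wordBasis_apply, wsize_eq_zero_iff.1 hw, wmon_nil])
    (map_one (augA k n))
    (fun w hw => by
      rw [wordBasis_apply]
      refine (augA_wmon w).trans (if_neg ?_)
      rintro rfl
      exact hw wsize_nil)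
    (fun v w => by
      simp only [wordBasis_apply]
      exact Submodule.subset_span ⟨v ++ w, wsize_append v w, (wmon_append k v w).symm⟩)
  simp only [wordBasis_apply] at this
  exact this

end Coproduct

/-- The tensor algebra `A_n` on planar rooted trees with
`n`-coloured edges has a natural family of graded connected Hopf algebra
structures indexed by `(q_{11},…,q_{2n}) ∈ k^{2n}`, graded by the number of
vertices, with coproduct described inductively by
`Δ(λ(f_1,…,f_n)) = Σ q_{11}^{|f'_1|}⋯q_{1n}^{|f'_n|} f'_1⋯f'_n ⊗ λ(f''_1,…,f''_n)
 + Σ λ(f'_1,…,f'_n) ⊗ q_{21}^{|f''_1|}⋯q_{2n}^{|f''_n|} f''_1⋯f''_n`,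
i.e. `Δ ∘ λ = (σ₁,σ₂) ∘ Δ^{⊗n}` with `σᵢ(t_1,…,t_n) = ∏_j q_{ij}^{|t_j|} t_1⋯t_n`. -/
theorem freeAlgebra_family_of_graded_connected_Hopf_structures
    (k : Type) [Field k] [CharZero k] (n : ℕ)
    (lam : (⨂[k]^n (FreeAlgebra k (PlTree n))) →ₗ[k] FreeAlgebra k (PlTree n))
    (hlam : ∀ g : Fin n → List (PlTree n),
      lam (tprod k fun i => wmon k (g i)) = FreeAlgebra.ι k (pgraftW g))
    (τ : (⨂[k]^n (FreeAlgebra k (PlTree n) ⊗[k] FreeAlgebra k (PlTree n))) ≃ₗ[k]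
          (⨂[k]^n (FreeAlgebra k (PlTree n))) ⊗[k] (⨂[k]^n (FreeAlgebra k (PlTree n))))
    (hτ : ∀ a b : Fin n → FreeAlgebra k (PlTree n),
      τ (tprod k fun i => a i ⊗ₜ[k] b i) = (tprod k a) ⊗ₜ[k] (tprod k b))
    (q : Fin 2 → Fin n → k) :
    ∃ (σ : Fin 2 → ((⨂[k]^n (FreeAlgebra k (PlTree n))) →ₗ[k] FreeAlgebra k (PlTree n)))
      (Δ : FreeAlgebra k (PlTree n) →ₐ[k]
            FreeAlgebra k (PlTree n) ⊗[k] FreeAlgebra k (PlTree n))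
      (S : FreeAlgebra k (PlTree n) →ₗ[k] FreeAlgebra k (PlTree n)),
      -- `σᵢ(t_1,…,t_n) = ∏_j q_{ij}^{|t_j|} · t_1⋯t_n` on basis words
      (∀ (i : Fin 2) (g : Fin n → List (PlTree n)),
        σ i (tprod k fun j => wmon k (g j))
          = (∏ j, q i j ^ wsize (g j)) • wmon k (List.ofFn g).flatten) ∧
      -- inductive description of the coproduct
      (Δ.toLinearMap ∘ₗ lam
        = ((TensorProduct.map (σ 0) lam + TensorProduct.map lam (σ 1)) ∘ₗ τ.toLinearMap)
            ∘ₗ (PiTensorProduct.map fun _ : Fin n => Δ.toLinearMap)) ∧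
      -- counit equation `ε ∘ λ = 0`
      ((augA k n).toLinearMap ∘ₗ lam = 0) ∧
      -- coassociativity
      ((TensorProduct.assoc k _ _ _).toLinearMap
          ∘ₗ (TensorProduct.map Δ.toLinearMap LinearMap.id) ∘ₗ Δ.toLinearMap
        = (TensorProduct.map LinearMap.id Δ.toLinearMap) ∘ₗ Δ.toLinearMap) ∧
      -- counit laws
      ((TensorProduct.lid k _).toLinearMap
          ∘ₗ (TensorProduct.map (augA k n).toLinearMap LinearMap.id) ∘ₗ Δ.toLinearMap
        = LinearMap.id) ∧
      ((TensorProduct.rid k _).toLinearMap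
          ∘ₗ (TensorProduct.map LinearMap.id (augA k n).toLinearMap) ∘ₗ Δ.toLinearMap
        = LinearMap.id) ∧
      -- the coproduct respects the grading by number of vertices
      (∀ w : List (PlTree n), Δ (wmon k w) ∈ Submodule.span k
        {y | ∃ a b : List (PlTree n), wsize a + wsize b = wsize w ∧
          y = wmon k a ⊗ₜ[k] wmon k b}) ∧
      -- connectedness: the degree-0 part is spanned by the unit
      (Submodule.span k {x | ∃ w : List (PlTree n), wsize w = 0 ∧ x = wmon k w}
        = Submodule.span k {(1 : FreeAlgebra k (PlTree n))}) ∧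
      -- `S` is an antipode
      ((LinearMap.mul' k (FreeAlgebra k (PlTree n)))
          ∘ₗ (TensorProduct.map S LinearMap.id) ∘ₗ Δ.toLinearMap
        = (Algebra.linearMap k (FreeAlgebra k (PlTree n))) ∘ₗ (augA k n).toLinearMap) ∧
      ((LinearMap.mul' k (FreeAlgebra k (PlTree n)))
          ∘ₗ (TensorProduct.map LinearMap.id S) ∘ₗ Δ.toLinearMap
        = (Algebra.linearMap k (FreeAlgebra k (PlTree n))) ∘ₗ (augA k n).toLinearMap) ∧
      -- the antipode preserves the grading
      (∀ w : List (PlTree n), S (wmon k w) ∈ Submodule.span k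
        {x | ∃ v : List (PlTree n), wsize v = wsize w ∧ x = wmon k v}) := by
  have hτ' : ∀ a b : Fin n → FreeAlgebra k (PlTree n),
      τ.toLinearMap (tprod k fun i => a i ⊗ₜ[k] b i) = (tprod k a) ⊗ₜ[k] (tprod k b) := hτ
  obtain ⟨S, hS_left, hS_right, hS_mem⟩ := exists_antipode_coproduct q hlam hτ'
  refine ⟨fun i => sigmaHom (q i), coproduct lam τ.toLinearMap q, S,
    fun i g => sigmaHom_tprod_wmon (q i) g, coproduct_comp_graft q hlam, augA_comp_graft hlam,
    coproduct_coassoc q hlam hτ', coproduct_counit_left q hlam hτ',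
    coproduct_counit_right q hlam hτ', coproduct_wmon_mem q hlam hτ', ?_,
    hS_left, hS_right, hS_mem⟩
  congr 1
  ext x
  simp [wsize_eq_zero_iff, wmon_nil]

end CTrees
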